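/- arXiv:2006.09009 — 4 statements merged into one kernel-verified Lean document; each statement's English description precedes it below -/
import Mathlib

section
/- Assume X'ᵀX' is invertible. A pair (β̂, γ̂) ∈ ℝ^p × ℝ^n minimizes the joint objective (β, γ) ↦ (1/(2n))‖y − Xβ − γ‖₂² + (η/(2m))‖ỹ − X̃β‖₂² + λ‖γ‖₁ if and only if γ̂ minimizes the Lasso objective γ ↦ (1/(2n))‖P_{X'}^⊥ y' − P̄ γ‖₂² + λ‖γ‖₁ and β̂ = (X'ᵀX')^{-1} X'ᵀ (y' − [γ̂; 0_m]). In particular, the two optimization problems share the same set of solutions for γ̂. -/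
open Matrix MeasureTheory ProbabilityTheory
open scoped BigOperators ENNReal

noncomputable section

namespace Debug

variable {ι κ : Type*} [Fintype ι] [Fintype κ]

/-- Squared Euclidean norm of a vector. -/
def sqNorm (v : ι → ℝ) : ℝ := ∑ i, v i ^ 2

/-- ℓ¹ norm of a vector. -/
def norm1 (v : ι → ℝ) : ℝ := ∑ i, |v i|

/-- ℓ∞ norm of a vector. -/
def normInf (v : ι → ℝ) : ℝ := ⨆ i, |v i|

/-- ℓ∞ operator norm of a matrix (maximum row ℓ¹ norm). -/
def matNormInf (M : Matrix ι κ ℝ) : ℝ := ⨆ i, ∑ j, |M i j|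

/-- Elementwise max norm of a matrix. -/
def matNormMax (M : Matrix ι κ ℝ) : ℝ := ⨆ i, ⨆ j, |M i j|

/-- Spectral norm of a matrix. -/
def specNorm (M : Matrix ι κ ℝ) : ℝ :=
  ⨆ v : {v : κ → ℝ // sqNorm v ≤ 1}, Real.sqrt (sqNorm (M.mulVec v.1))

/-- Minimum eigenvalue of a symmetric matrix, as the minimum Rayleigh quotient. -/
def minEig (M : Matrix ι ι ℝ) : ℝ :=
  ⨅ v : {v : ι → ℝ // sqNorm v = 1}, v.1 ⬝ᵥ M.mulVec v.1

/-- Maximum eigenvalue of a symmetric matrix, as the maximum Rayleigh quotient. -/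
def maxEig (M : Matrix ι ι ℝ) : ℝ :=
  ⨆ v : {v : ι → ℝ // sqNorm v = 1}, v.1 ⬝ᵥ M.mulVec v.1

variable [DecidableEq ι] [DecidableEq κ]

/-- Projection onto the column space of `A`. -/
def proj (A : Matrix ι κ ℝ) : Matrix ι ι ℝ := A * (Aᵀ * A)⁻¹ * Aᵀ

/-- Projection onto the orthogonal complement of the column space of `A`. -/
def projPerp (A : Matrix ι κ ℝ) : Matrix ι ι ℝ := 1 - proj A

variable {n m p : ℕ}

/-- The stacked design matrix `X' = [X; √(ηn/m)·X̃]`. -/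
def stackM (η : ℝ) (X : Matrix (Fin n) (Fin p) ℝ) (Xt : Matrix (Fin m) (Fin p) ℝ) :
    Matrix (Fin n ⊕ Fin m) (Fin p) ℝ :=
  Matrix.fromRows X (Real.sqrt (η * n / m) • Xt)

/-- The stacked vector `[v; √(ηn/m)·vt]` (with `n, m` the two pool sizes). -/
def stackV (η : ℝ) (n m : ℕ) (v : Fin n → ℝ) (vt : Fin m → ℝ) : Fin n ⊕ Fin m → ℝ :=
  Sum.elim v fun i => Real.sqrt (η * n / m) * vt i

/-- `P̄`: the submatrix of `P_{X'}^⊥` obtained by deleting the last `m` columns. -/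
def Pbar (η : ℝ) (X : Matrix (Fin n) (Fin p) ℝ) (Xt : Matrix (Fin m) (Fin p) ℝ) :
    Matrix (Fin n ⊕ Fin m) (Fin n) ℝ :=
  (projPerp (stackM η X Xt)).submatrix id Sum.inl

/-- The two-pool Lasso objective `γ ↦ (1/(2n))‖P_{X'}^⊥ y' − P̄γ‖₂² + λ‖γ‖₁`. -/
def lassoObj2 (η lam : ℝ) (X : Matrix (Fin n) (Fin p) ℝ) (Xt : Matrix (Fin m) (Fin p) ℝ)
    (y : Fin n → ℝ) (yt : Fin m → ℝ) (γ : Fin n → ℝ) : ℝ :=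
  (1 / (2 * (n : ℝ))) *
      sqNorm ((projPerp (stackM η X Xt)).mulVec (stackV η n m y yt) - (Pbar η X Xt).mulVec γ)
    + lam * norm1 γ

/-- The one-pool Lasso objective `γ ↦ (1/(2n))‖P_X^⊥ y − P_X^⊥ γ‖₂² + λ‖γ‖₁`. -/
def lassoObj1 (lam : ℝ) (X : Matrix (Fin n) (Fin p) ℝ) (y : Fin n → ℝ) (γ : Fin n → ℝ) : ℝ :=
  (1 / (2 * (n : ℝ))) * sqNorm ((projPerp X).mulVec y - (projPerp X).mulVec γ) + lam * norm1 γ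

/-- The `T × T` block of `P_{X'}^⊥`. -/
def blockTT (η : ℝ) (X : Matrix (Fin n) (Fin p) ℝ) (Xt : Matrix (Fin m) (Fin p) ℝ)
    (T : Finset (Fin n)) : Matrix ↥T ↥T ℝ :=
  (projPerp (stackM η X Xt)).submatrix (fun i => Sum.inl i.1) (fun j => Sum.inl j.1)

/-- The `T^c × T` block of `P_{X'}^⊥`. -/
def blockTcT (η : ℝ) (X : Matrix (Fin n) (Fin p) ℝ) (Xt : Matrix (Fin m) (Fin p) ℝ)
    (T : Finset (Fin n)) : Matrix {i : Fin n // i ∉ T} ↥T ℝ :=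
  (projPerp (stackM η X Xt)).submatrix (fun i => Sum.inl i.1) (fun j => Sum.inl j.1)

/-- The `T × ·` block (rows indexed by `T`) of `P_{X'}^⊥`. -/
def blockTdot (η : ℝ) (X : Matrix (Fin n) (Fin p) ℝ) (Xt : Matrix (Fin m) (Fin p) ℝ)
    (T : Finset (Fin n)) : Matrix ↥T (Fin n ⊕ Fin m) ℝ :=
  (projPerp (stackM η X Xt)).submatrix (fun i => Sum.inl i.1) id

/-- Columns of `P̄` indexed by `T`. -/
def PbarT (η : ℝ) (X : Matrix (Fin n) (Fin p) ℝ) (Xt : Matrix (Fin m) (Fin p) ℝ)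
    (T : Finset (Fin n)) : Matrix (Fin n ⊕ Fin m) ↥T ℝ :=
  (Pbar η X Xt).submatrix id (fun j => j.1)

/-- Columns of `P̄` indexed by `T^c`. -/
def PbarTc (η : ℝ) (X : Matrix (Fin n) (Fin p) ℝ) (Xt : Matrix (Fin m) (Fin p) ℝ)
    (T : Finset (Fin n)) : Matrix (Fin n ⊕ Fin m) {i : Fin n // i ∉ T} ℝ :=
  (Pbar η X Xt).submatrix id (fun j => j.1)

/-- `G'(λ)` from the support recovery theorems. -/
def Gprime (η lam : ℝ) (X : Matrix (Fin n) (Fin p) ℝ) (Xt : Matrix (Fin m) (Fin p) ℝ)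
    (T : Finset (Fin n)) (εp : Fin n ⊕ Fin m → ℝ) : ℝ :=
  normInf ((blockTT η X Xt T)⁻¹.mulVec ((blockTdot η X Xt T).mulVec εp))
    + (n : ℝ) * lam * matNormInf (blockTT η X Xt T)⁻¹

/-- The lower bound on the regularization parameter in the support recovery theorems. -/
def lamLB (η : ℝ) (X : Matrix (Fin n) (Fin p) ℝ) (Xt : Matrix (Fin m) (Fin p) ℝ)
    (T : Finset (Fin n)) (αp : ℝ) (εp : Fin n ⊕ Fin m → ℝ) : ℝ :=
  (2 / (1 - αp)) * normInf ((PbarTc η X Xt T)ᵀ.mulVec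
    ((1 - PbarT η X Xt T * ((PbarT η X Xt T)ᵀ * PbarT η X Xt T)⁻¹ * (PbarT η X Xt T)ᵀ).mulVec
      ((n : ℝ)⁻¹ • εp)))

/-- One-pool `T × T` block of `P_X^⊥`. -/
def blockTT1 (X : Matrix (Fin n) (Fin p) ℝ) (T : Finset (Fin n)) : Matrix ↥T ↥T ℝ :=
  (projPerp X).submatrix (fun i => i.1) (fun j => j.1)

/-- One-pool `T^c × T` block of `P_X^⊥`. -/
def blockTcT1 (X : Matrix (Fin n) (Fin p) ℝ) (T : Finset (Fin n)) :
    Matrix {i : Fin n // i ∉ T} ↥T ℝ :=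
  (projPerp X).submatrix (fun i => i.1) (fun j => j.1)

/-- One-pool `T × ·` block of `P_X^⊥`. -/
def blockTdot1 (X : Matrix (Fin n) (Fin p) ℝ) (T : Finset (Fin n)) : Matrix ↥T (Fin n) ℝ :=
  (projPerp X).submatrix (fun i => i.1) id

/-- A real random variable `Z` is (mean-zero) sub-Gaussian with variance parameter `σ2`. -/
def IsSubG {Ω : Type*} [MeasurableSpace Ω] (μ : Measure Ω) (Z : Ω → ℝ) (σ2 : ℝ) : Prop :=
  ∀ s : ℝ, ∫ ω, Real.exp (s * Z ω) ∂μ ≤ Real.exp (σ2 * s ^ 2 / 2)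

/-- A random vector `Z` is sub-Gaussian with parameter `σ2`. -/
def IsSubGVec {Ω : Type*} [MeasurableSpace Ω] (μ : Measure Ω) {p : ℕ}
    (Z : Ω → Fin p → ℝ) (σ2 : ℝ) : Prop :=
  ∀ u : Fin p → ℝ, sqNorm u = 1 → IsSubG μ (fun ω => ∑ j, u j * Z ω j) σ2

end Debug

namespace Debug

section LeastSquares

variable {ι κ : Type*} [Fintype ι] [Fintype κ]

theorem sqNorm_eq_dotProduct (v : ι → ℝ) : sqNorm v = v ⬝ᵥ v := by
  simp [sqNorm, dotProduct, pow_two]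

theorem sqNorm_nonneg (v : ι → ℝ) : 0 ≤ sqNorm v :=
  Finset.sum_nonneg fun i _ => sq_nonneg (v i)

theorem sqNorm_eq_zero {v : ι → ℝ} : sqNorm v = 0 ↔ v = 0 := by
  rw [sqNorm_eq_dotProduct, dotProduct_self_eq_zero]

theorem sqNorm_sub_of_dotProduct_eq_zero {u v : ι → ℝ} (h : u ⬝ᵥ v = 0) :
    sqNorm (u - v) = sqNorm u + sqNorm v := by
  simp only [sqNorm_eq_dotProduct, sub_dotProduct, dotProduct_sub, h, dotProduct_comm v u]
  ring

theorem sqNorm_const_mul (c : ℝ) (v : ι → ℝ) : sqNorm (fun i => c * v i) = c ^ 2 * sqNorm v := by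
  simp [sqNorm, mul_pow, Finset.mul_sum]

theorem sqNorm_sumElim (u : ι → ℝ) (v : κ → ℝ) :
    sqNorm (Sum.elim u v) = sqNorm u + sqNorm v := by
  simp [sqNorm]

variable [DecidableEq κ]

/-- The least-squares coefficients of the regression of `w` on the columns of `A`. -/
def lsCoef (A : Matrix ι κ ℝ) (w : ι → ℝ) : κ → ℝ := (Aᵀ * A)⁻¹.mulVec (Aᵀ.mulVec w)

theorem transpose_mulVec_residual {A : Matrix ι κ ℝ} (hA : IsUnit (Aᵀ * A).det) (w : ι → ℝ) :
    Aᵀ.mulVec (w - A.mulVec (lsCoef A w)) = 0 := by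
  rw [mulVec_sub, lsCoef, mulVec_mulVec, mulVec_mulVec, mul_nonsing_inv _ hA, one_mulVec, sub_self]

theorem mulVec_eq_zero_of_isUnit_gram {A : Matrix ι κ ℝ} (hA : IsUnit (Aᵀ * A).det) {β : κ → ℝ}
    (h : A.mulVec β = 0) : β = 0 := by
  rw [← one_mulVec β, ← nonsing_inv_mul _ hA, ← mulVec_mulVec, ← mulVec_mulVec, h]
  simp

variable [DecidableEq ι]

theorem projPerp_mulVec (A : Matrix ι κ ℝ) (w : ι → ℝ) :
    (projPerp A).mulVec w = w - A.mulVec (lsCoef A w) := by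
  simp [projPerp, proj, lsCoef, sub_mulVec, mulVec_mulVec, Matrix.mul_assoc]

theorem sqNorm_sub_mulVec {A : Matrix ι κ ℝ} (hA : IsUnit (Aᵀ * A).det) (w : ι → ℝ) (β : κ → ℝ) :
    sqNorm (w - A.mulVec β) =
      sqNorm ((projPerp A).mulVec w) + sqNorm (A.mulVec (β - lsCoef A w)) := by
  rw [← sqNorm_sub_of_dotProduct_eq_zero, projPerp_mulVec, mulVec_sub]
  · congr 1
    abel
  · rw [dotProduct_mulVec, ← mulVec_transpose, projPerp_mulVec, transpose_mulVec_residual hA,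
      zero_dotProduct]

end LeastSquares

section TwoPool

variable {n m p : ℕ}

theorem Pbar_mulVec (η : ℝ) (X : Matrix (Fin n) (Fin p) ℝ) (Xt : Matrix (Fin m) (Fin p) ℝ)
    (γ : Fin n → ℝ) :
    (Pbar η X Xt).mulVec γ = (projPerp (stackM η X Xt)).mulVec (Sum.elim γ fun _ => 0) := by
  ext i
  simp [Pbar, mulVec, dotProduct]

theorem stackV_sub_sub_stackM_mulVec (η : ℝ) (X : Matrix (Fin n) (Fin p) ℝ)
    (Xt : Matrix (Fin m) (Fin p) ℝ) (y : Fin n → ℝ) (yt : Fin m → ℝ)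
    (β : Fin p → ℝ) (γ : Fin n → ℝ) :
    stackV η n m y yt - (Sum.elim γ fun _ => 0) - (stackM η X Xt).mulVec β =
      Sum.elim (y - X.mulVec β - γ)
        fun i => Real.sqrt (η * n / m) * (yt - Xt.mulVec β) i := by
  ext (i | i)
  · simp [stackV, stackM, fromRows_mulVec]
    ring
  · simp [stackV, stackM, fromRows_mulVec, smul_mulVec]
    ring

theorem jointObj_eq_lassoObj2_add (hn : 0 < n) {η : ℝ} (hη : 0 ≤ η) (lam : ℝ)
    {X : Matrix (Fin n) (Fin p) ℝ} {Xt : Matrix (Fin m) (Fin p) ℝ}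
    (hinv : IsUnit ((stackM η X Xt)ᵀ * stackM η X Xt).det)
    (y : Fin n → ℝ) (yt : Fin m → ℝ) (β : Fin p → ℝ) (γ : Fin n → ℝ) :
    (1 / (2 * (n : ℝ))) * sqNorm (y - X.mulVec β - γ)
        + (η / (2 * (m : ℝ))) * sqNorm (yt - Xt.mulVec β) + lam * norm1 γ =
      lassoObj2 η lam X Xt y yt γ + (1 / (2 * (n : ℝ))) *
        sqNorm ((stackM η X Xt).mulVec
          (β - lsCoef (stackM η X Xt) (stackV η n m y yt - Sum.elim γ fun _ => 0))) := by
  have key := sqNorm_sub_mulVec hinv (stackV η n m y yt - Sum.elim γ fun _ => 0) β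
  rw [stackV_sub_sub_stackM_mulVec, sqNorm_sumElim, sqNorm_const_mul,
    Real.sq_sqrt (by positivity), mulVec_sub, ← Pbar_mulVec] at key
  have hn' : (n : ℝ) ≠ 0 := by positivity
  have hcoef : η / (2 * (m : ℝ)) = 1 / (2 * (n : ℝ)) * (η * n / m) := by
    field_simp
  rw [lassoObj2, hcoef]
  linear_combination (1 / (2 * (n : ℝ))) * key

end TwoPool

/-- the joint optimization and the Lasso reformulation share the same
solutions (Lemma on reformulation). -/
theorem statement_1
    (n m p : ℕ) (hn : 0 < n) (hm : 0 < m)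
    (η lam : ℝ) (hη : 0 < η) (hlam : 0 < lam)
    (X : Matrix (Fin n) (Fin p) ℝ) (y : Fin n → ℝ)
    (Xt : Matrix (Fin m) (Fin p) ℝ) (yt : Fin m → ℝ)
    (hinv : IsUnit ((stackM η X Xt)ᵀ * stackM η X Xt).det)
    (jointObj : (Fin p → ℝ) → (Fin n → ℝ) → ℝ)
    (hjoint : jointObj = fun β γ =>
      (1 / (2 * (n : ℝ))) * sqNorm (y - X.mulVec β - γ)
        + (η / (2 * (m : ℝ))) * sqNorm (yt - Xt.mulVec β) + lam * norm1 γ)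
    (βh : Fin p → ℝ) (γh : Fin n → ℝ) :
    (∀ β γ, jointObj βh γh ≤ jointObj β γ) ↔
      ((∀ γ, lassoObj2 η lam X Xt y yt γh ≤ lassoObj2 η lam X Xt y yt γ) ∧
        βh = ((stackM η X Xt)ᵀ * stackM η X Xt)⁻¹.mulVec
          ((stackM η X Xt)ᵀ.mulVec (stackV η n m y yt - Sum.elim γh fun _ => 0))) := by
  have hsplit (β : Fin p → ℝ) (γ : Fin n → ℝ) :=
    jointObj_eq_lassoObj2_add hn hη.le lam hinv y yt β γ
  have hc : 0 < 1 / (2 * (n : ℝ)) := by positivity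
  subst hjoint
  simp only [hsplit]
  change _ ↔ _ ∧ βh = lsCoef (stackM η X Xt) (stackV η n m y yt - Sum.elim γh fun _ => 0)
  constructor
  · intro h
    have hfit (γ : Fin n → ℝ) :=
      h (lsCoef (stackM η X Xt) (stackV η n m y yt - Sum.elim γ fun _ => 0)) γ
    simp only [sub_self, mulVec_zero, sqNorm_eq_zero.mpr, mul_zero, add_zero] at hfit
    refine ⟨fun γ => le_trans (le_add_of_nonneg_right
      (mul_nonneg hc.le (sqNorm_nonneg _))) (hfit γ), ?_⟩
    have hzero := nonpos_of_mul_nonpos_right (add_le_iff_nonpos_right _ |>.mp (hfit γh)) hc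
    exact sub_eq_zero.mp (mulVec_eq_zero_of_isUnit_gram hinv
      (sqNorm_eq_zero.mp (le_antisymm hzero (sqNorm_nonneg _))))
  · rintro ⟨hγ, rfl⟩ β γ
    simp only [sub_self, mulVec_zero, sqNorm_eq_zero.mpr, mul_zero, add_zero]
    exact (hγ γ).trans (le_add_of_nonneg_right (mul_nonneg hc.le (sqNorm_nonneg _)))

end Debug
end
end

section
/- In the orthogonal design setting, the support-recovery conditions admit closed forms: (i) one pool: λ_min(P_{X,TT}^⊥) = 1/(max_{1≤i≤t}(r_i/f_i)² + 1) = min_{1≤i≤t} f_i²/(r_i² + f_i²) and ‖P_{X,T^cT}^⊥ (P_{X,TT}^⊥)^{-1}‖_∞ = max_{1≤i≤t} |r_i/f_i|; (ii) two pools: λ_min(P_{X',TT}^⊥) = 1/(max_{1≤i≤t} r_i²/(f_i² + (ηn/m)w_i²) + 1) = min_{1≤i≤t} (f_i² + (ηn/m)w_i²)/(r_i² + f_i² + (ηn/m)w_i²) and ‖P_{X',T^cT}^⊥ (P_{X',TT}^⊥)^{-1}‖_∞ = max_{1≤i≤t} |r_i f_i / (f_i² + (ηn/m)w_i²)|. 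-/
open Matrix MeasureTheory ProbabilityTheory
open scoped BigOperators ENNReal

noncomputable section

namespace Debug

lemma iSup_eq_of_forall_le {ι : Type*} [Finite ι] {x : ι → ℝ} {i₀ : ι}
    (h : ∀ i, x i ≤ x i₀) : ⨆ i, x i = x i₀ :=
  have : Nonempty ι := ⟨i₀⟩
  le_antisymm (ciSup_le h) (le_ciSup (Set.finite_range x).bddAbove i₀)

lemma iInf_eq_of_forall_le {ι : Type*} [Finite ι] {x : ι → ℝ} {i₀ : ι}
    (h : ∀ i, x i₀ ≤ x i) : ⨅ i, x i = x i₀ :=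
  have : Nonempty ι := ⟨i₀⟩
  le_antisymm (ciInf_le (Set.finite_range x).bddBelow i₀) (le_ciInf h)

lemma one_div_iSup_add_one {ι : Type*} [Finite ι] [Nonempty ι] (x : ι → ℝ) (hx : ∀ i, 0 ≤ x i) :
    1 / ((⨆ i, x i) + 1) = ⨅ i, 1 / (x i + 1) := by
  obtain ⟨i₀, hi₀⟩ := Finite.exists_max x
  rw [iSup_eq_of_forall_le hi₀,
    iInf_eq_of_forall_le (x := fun i => 1 / (x i + 1)) (i₀ := i₀) fun i => ?_]
  have := hx i
  have := hi₀ i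
  exact one_div_le_one_div_of_le (by linarith) (by linarith)

lemma minEig_diagonal {ι : Type*} [Fintype ι] [DecidableEq ι] [Nonempty ι] (d : ι → ℝ) :
    minEig (diagonal d) = ⨅ i, d i := by
  obtain ⟨i₀, hi₀⟩ := Finite.exists_min d
  have key : ∀ v : {v : ι → ℝ // sqNorm v = 1},
      d i₀ ≤ v.1 ⬝ᵥ (diagonal d).mulVec v.1 := by
    rintro ⟨v, hv⟩
    calc d i₀ = ∑ i, d i₀ * v i ^ 2 := by
          rw [← Finset.mul_sum, show ∑ i, v i ^ 2 = 1 from hv, mul_one]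
      _ ≤ ∑ i, d i * v i ^ 2 := by
          gcongr with i
          exact hi₀ i
      _ = v ⬝ᵥ (diagonal d).mulVec v := by
          simp only [dotProduct, mulVec_diagonal]
          exact Finset.sum_congr rfl fun i _ => by ring
  have hunit : sqNorm (Pi.single i₀ 1 : ι → ℝ) = 1 := by
    simp [sqNorm, Pi.single_apply]
  have : Nonempty {v : ι → ℝ // sqNorm v = 1} := ⟨⟨_, hunit⟩⟩
  rw [iInf_eq_of_forall_le hi₀]
  refine le_antisymm ?_ (le_ciInf key)
  refine (ciInf_le ⟨d i₀, ?_⟩ ⟨Pi.single i₀ 1, hunit⟩).trans_eq ?_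
  · rintro _ ⟨v, rfl⟩
    exact key v
  · simp

/-- `P_A^⊥` for `A = B Qᵀ` with `Q` orthogonal and `B` having a diagonal Gram matrix. -/
lemma projPerp_mul_transpose_apply {ι κ : Type*} [Fintype ι] [DecidableEq ι] [Fintype κ]
    [DecidableEq κ] {Q : Matrix κ κ ℝ} (hQ : Qᵀ * Q = 1) (B : Matrix ι κ ℝ) {d : κ → ℝ}
    (hB : Bᵀ * B = diagonal d) (hd : ∀ l, d l ≠ 0) (i j : ι) :
    projPerp (B * Qᵀ) i j = (if i = j then 1 else 0) - ∑ l, B i l * B j l / d l := by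
  have hQ' : Q * Qᵀ = 1 := mul_eq_one_comm.mp hQ
  have hgram : ((B * Qᵀ)ᵀ * (B * Qᵀ))⁻¹ = Q * diagonal (fun l => (d l)⁻¹) * Qᵀ := by
    refine inv_eq_right_inv ?_
    have h1 : (B * Qᵀ)ᵀ * (B * Qᵀ) = Q * diagonal d * Qᵀ := by
      rw [transpose_mul, transpose_transpose, ← hB]
      simp only [Matrix.mul_assoc]
    calc (B * Qᵀ)ᵀ * (B * Qᵀ) * (Q * diagonal (fun l => (d l)⁻¹) * Qᵀ)
        = Q * (diagonal d * (Qᵀ * Q) * diagonal (fun l => (d l)⁻¹)) * Qᵀ := by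
          rw [h1]; simp only [Matrix.mul_assoc]
      _ = 1 := by
          rw [hQ, Matrix.mul_one, diagonal_mul_diagonal]
          simp [hd, hQ']
  have hproj : proj (B * Qᵀ) = B * diagonal (fun l => (d l)⁻¹) * Bᵀ := by
    calc proj (B * Qᵀ)
        = B * ((Qᵀ * Q) * diagonal (fun l => (d l)⁻¹) * (Qᵀ * Q)) * Bᵀ := by
          rw [proj, hgram, transpose_mul, transpose_transpose]
          simp only [Matrix.mul_assoc]
      _ = _ := by rw [hQ, Matrix.one_mul, Matrix.mul_one, Matrix.mul_assoc]
  rw [projPerp, hproj, Matrix.sub_apply, one_apply, mul_apply]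
  congr 1
  refine Finset.sum_congr rfl fun l _ => ?_
  rw [mul_diagonal, transpose_apply]
  ring

lemma sum_ite_mul_ite_of_injective {ι κ : Type*} [Fintype ι] [DecidableEq κ] {e : ι → κ}
    (he : Function.Injective e) {x : ι → ℝ} {y : κ → ℝ} (hy : ∀ i, y (e i) = x i)
    (hy0 : ∀ a, (∀ i, e i ≠ a) → y a = 0) (a b : κ) :
    ∑ i, (if a = e i then x i else 0) * (if b = e i then x i else 0)
      = if a = b then y a ^ 2 else 0 := by
  classical
  by_cases ha : ∃ i, e i = a
  · obtain ⟨i, rfl⟩ := ha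
    rw [Finset.sum_eq_single i]
    · by_cases h : e i = b
      · simp [h, ← hy, sq]
      · simp [h, Ne.symm h]
    · intro j _ hj
      rw [if_neg fun h => hj (he h).symm, zero_mul]
    · simp
  · push Not at ha
    rw [hy0 a ha, Finset.sum_eq_zero fun i _ => by rw [if_neg (ha i).symm, zero_mul]]
    simp

/-- Closed forms for the blocks of `P^⊥` when the `T` rows are scaled distinct basis vectors. -/
lemma closed_forms_of_blocks {ι κ : Type*} [Fintype ι] [DecidableEq ι] [Nonempty ι] [Fintype κ]
    [DecidableEq κ] {e : ι → κ} (he : Function.Injective e) {r : ι → ℝ} {f g : κ → ℝ}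
    (hg : ∀ l, 0 < g l) {M : Matrix ι ι ℝ} {N : Matrix κ ι ℝ}
    (hM : M = diagonal fun i => g (e i) / (r i ^ 2 + g (e i)))
    (hN : N = of fun l i => if l = e i then -(f l * r i / (r i ^ 2 + g l)) else 0) :
    minEig M = 1 / ((⨆ i, r i ^ 2 / g (e i)) + 1)
      ∧ minEig M = ⨅ i, g (e i) / (r i ^ 2 + g (e i))
      ∧ matNormInf (N * M⁻¹) = ⨆ i, |r i * f (e i) / g (e i)| := by
  have hmin : minEig M = ⨅ i, g (e i) / (r i ^ 2 + g (e i)) := by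
    rw [hM, minEig_diagonal]
  refine ⟨?_, hmin, ?_⟩
  · rw [hmin, one_div_iSup_add_one _ fun i => div_nonneg (sq_nonneg _) (hg _).le]
    congr 1
    funext i
    have := hg (e i)
    field_simp
  have hpos : ∀ i, 0 < r i ^ 2 + g (e i) := fun i => add_pos_of_nonneg_of_pos (sq_nonneg _) (hg _)
  have hinv : M⁻¹ = diagonal fun i => (r i ^ 2 + g (e i)) / g (e i) := by
    refine inv_eq_right_inv ?_
    rw [hM, diagonal_mul_diagonal, ← diagonal_one]
    congr 1
    funext i
    have := (hg (e i)).ne'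
    have := (hpos i).ne'
    field_simp
  have hentry : ∀ l i, |(N * M⁻¹) l i| = if l = e i then |r i * f (e i) / g (e i)| else 0 := by
    intro l i
    rw [hinv, mul_diagonal, hN, of_apply]
    split_ifs with h
    · subst h
      rw [← abs_neg]
      congr 1
      have := (hg (e i)).ne'
      have := (hpos i).ne'
      field_simp
    · simp
  have hrow : ∀ i, ∑ j, |(N * M⁻¹) (e i) j| = |r i * f (e i) / g (e i)| := by
    intro i
    simp only [hentry, he.eq_iff]
    simp
  obtain ⟨i₀, hi₀⟩ := Finite.exists_max fun i => |r i * f (e i) / g (e i)|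
  rw [matNormInf, iSup_eq_of_forall_le hi₀, iSup_eq_of_forall_le (i₀ := e i₀), hrow]
  intro l
  rw [hrow]
  by_cases hl : ∃ i, e i = l
  · obtain ⟨i, rfl⟩ := hl
    rw [hrow]
    exact hi₀ i
  · push Not at hl
    rw [Finset.sum_eq_zero fun i _ => by rw [hentry, if_neg (hl i).symm]]
    positivity

/-- Closed forms for a design `B Qᵀ` whose rows selected by `a`, `b` are `r i • e_i`, `f l • e_l`
and whose Gram matrix in the basis `Q` is diagonal. -/
lemma closed_forms_of_gram {ι κ ν : Type*} [Fintype ι] [DecidableEq ι] [Nonempty ι] [Fintype κ]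
    [DecidableEq κ] [Fintype ν] [DecidableEq ν] {Q : Matrix κ κ ℝ} (hQ : Qᵀ * Q = 1)
    {e : ι → κ} (he : Function.Injective e) {r : ι → ℝ} {f g y : κ → ℝ} (hg : ∀ l, 0 < g l)
    (hy : ∀ i, y (e i) = r i) {B : Matrix ν κ ℝ}
    (hB : Bᵀ * B = diagonal fun l => y l ^ 2 + g l) {a : ι → ν} {b : κ → ν}
    (ha : Function.Injective a) (hab : ∀ l i, b l ≠ a i)
    (hBa : ∀ i l, B (a i) l = if l = e i then r i else 0)
    (hBb : ∀ i l, B (b i) l = if l = i then f i else 0) :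
    minEig ((projPerp (B * Qᵀ)).submatrix a a) = 1 / ((⨆ i, r i ^ 2 / g (e i)) + 1)
      ∧ minEig ((projPerp (B * Qᵀ)).submatrix a a) = ⨅ i, g (e i) / (r i ^ 2 + g (e i))
      ∧ matNormInf ((projPerp (B * Qᵀ)).submatrix b a * ((projPerp (B * Qᵀ)).submatrix a a)⁻¹)
        = ⨆ i, |r i * f (e i) / g (e i)| := by
  have hpos : ∀ l, y l ^ 2 + g l ≠ 0 := fun l =>
    (add_pos_of_nonneg_of_pos (sq_nonneg _) (hg l)).ne'
  refine closed_forms_of_blocks he hg ?_ ?_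
  · ext i j
    rw [submatrix_apply, projPerp_mul_transpose_apply hQ B hB hpos,
      Finset.sum_eq_single (e i) (fun l _ hl => by rw [hBa, if_neg hl]; simp) (by simp),
      diagonal_apply, hBa, hBa, hy, if_pos rfl]
    simp only [ha.eq_iff, he.eq_iff]
    have := hpos (e i)
    rw [hy] at this
    split_ifs with h
    · subst h
      field_simp
      ring
    · simp
  · ext l i
    rw [submatrix_apply, projPerp_mul_transpose_apply hQ B hB hpos, if_neg (hab l i),
      Finset.sum_eq_single l (fun l' _ hl => by rw [hBb, if_neg hl]; simp) (by simp),
      of_apply, hBa, hBb, if_pos rfl]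
    split_ifs with h
    · subst h
      rw [hy, zero_sub]
    · simp

/-- closed forms of the minimum-eigenvalue and mutual-incoherence
quantities in the orthogonal design setting. -/
theorem statement_4
    (p t m : ℕ) (ht : 0 < t) (hm : 0 < m) (hp : 0 < p) (htp : t ≤ p)
    (η : ℝ) (hη : 0 < η)
    (n : ℕ) (hn : n = t + p)
    (Q : Matrix (Fin p) (Fin p) ℝ) (hQ : Qᵀ * Q = 1)
    (r : Fin t → ℝ) (f : Fin p → ℝ) (hf : ∀ i, f i ≠ 0)
    (R : Matrix (Fin t) (Fin p) ℝ)
    (hR : R = Matrix.of fun (i : Fin t) (j : Fin p) => if (j : ℕ) = (i : ℕ) then r i else 0)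
    (X : Matrix (Fin t ⊕ Fin p) (Fin p) ℝ)
    (hX : X = Matrix.fromRows (R * Qᵀ) (Matrix.diagonal f * Qᵀ))
    (k : Fin m → Fin p) (hk : Function.Injective k)
    (wk : Fin m → ℝ) (w : Fin p → ℝ)
    (hw1 : ∀ j, w (k j) = wk j) (hw2 : ∀ i, (∀ j, k j ≠ i) → w i = 0)
    (W : Matrix (Fin m) (Fin p) ℝ)
    (hW : W = Matrix.of fun (j : Fin m) (i : Fin p) => if i = k j then wk j else 0)
    (Xt : Matrix (Fin m) (Fin p) ℝ) (hXt : Xt = W * Qᵀ)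
    (X' : Matrix ((Fin t ⊕ Fin p) ⊕ Fin m) (Fin p) ℝ)
    (hX' : X' = Matrix.fromRows X (Real.sqrt (η * n / m) • Xt)) :
    -- one-pool minimum eigenvalue
    (minEig ((projPerp X).submatrix Sum.inl Sum.inl)
        = 1 / ((⨆ i : Fin t, (r i / f (Fin.castLE htp i)) ^ 2) + 1)
      ∧ minEig ((projPerp X).submatrix Sum.inl Sum.inl)
        = ⨅ i : Fin t, (f (Fin.castLE htp i)) ^ 2 / ((r i) ^ 2 + (f (Fin.castLE htp i)) ^ 2))
    -- one-pool mutual incoherence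
    ∧ matNormInf ((projPerp X).submatrix Sum.inr Sum.inl
          * (((projPerp X).submatrix Sum.inl Sum.inl)⁻¹))
        = ⨆ i : Fin t, |r i / f (Fin.castLE htp i)|
    -- two-pool minimum eigenvalue
    ∧ (minEig ((projPerp X').submatrix (Sum.inl ∘ Sum.inl) (Sum.inl ∘ Sum.inl))
        = 1 / ((⨆ i : Fin t,
            (r i) ^ 2 / ((f (Fin.castLE htp i)) ^ 2 + (η * n / m) * (w (Fin.castLE htp i)) ^ 2)) + 1)
      ∧ minEig ((projPerp X').submatrix (Sum.inl ∘ Sum.inl) (Sum.inl ∘ Sum.inl))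
        = ⨅ i : Fin t,
            ((f (Fin.castLE htp i)) ^ 2 + (η * n / m) * (w (Fin.castLE htp i)) ^ 2)
              / ((r i) ^ 2 + (f (Fin.castLE htp i)) ^ 2 + (η * n / m) * (w (Fin.castLE htp i)) ^ 2))
    -- two-pool mutual incoherence
    ∧ matNormInf ((projPerp X').submatrix (Sum.inl ∘ Sum.inr) (Sum.inl ∘ Sum.inl)
          * (((projPerp X').submatrix (Sum.inl ∘ Sum.inl) (Sum.inl ∘ Sum.inl))⁻¹))
        = ⨆ i : Fin t,
            |r i * f (Fin.castLE htp i)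
              / ((f (Fin.castLE htp i)) ^ 2 + (η * n / m) * (w (Fin.castLE htp i)) ^ 2)| := by
  subst hR hX hW hXt hX'
  have : Nonempty (Fin t) := ⟨⟨0, ht⟩⟩
  have he : Function.Injective (Fin.castLE htp) := Fin.castLE_injective htp
  have hval : ∀ (i : Fin t) (l : Fin p), (l : ℕ) = (i : ℕ) ↔ l = Fin.castLE htp i := fun i l => by
    simp [Fin.ext_iff]
  simp only [hval]
  set y : Fin p → ℝ := Function.extend (Fin.castLE htp) r 0
  have hy : ∀ i, y (Fin.castLE htp i) = r i := fun i => he.extend_apply _ _ _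
  have hy0 : ∀ l, (∀ i, Fin.castLE htp i ≠ l) → y l = 0 := fun l hl =>
    Function.extend_apply' _ _ _ (by simpa using hl)
  set s := η * n / m
  have hs0 : 0 ≤ s := by positivity
  set R : Matrix (Fin t) (Fin p) ℝ :=
    of fun i l => if l = Fin.castLE htp i then r i else 0
  set W : Matrix (Fin m) (Fin p) ℝ := of fun j i => if i = k j then wk j else 0
  have hRR : Rᵀ * R = diagonal fun l => y l ^ 2 := by
    ext l l'
    rw [diagonal_apply, ← sum_ite_mul_ite_of_injective he hy hy0]
    rfl
  have hWW : Wᵀ * W = diagonal fun l => w l ^ 2 := by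
    ext l l'
    rw [diagonal_apply, ← sum_ite_mul_ite_of_injective hk hw1 hw2]
    rfl
  have hBB : (fromRows R (diagonal f))ᵀ * fromRows R (diagonal f)
      = diagonal fun l => y l ^ 2 + f l ^ 2 := by
    rw [transpose_fromRows, fromCols_mul_fromRows, hRR, diagonal_transpose, diagonal_mul_diagonal,
      diagonal_add]
    simp only [sq]
  have hBB' : (fromRows (fromRows R (diagonal f)) (√s • W))ᵀ
      * fromRows (fromRows R (diagonal f)) (√s • W)
      = diagonal fun l => y l ^ 2 + (f l ^ 2 + s * w l ^ 2) := by
    rw [transpose_fromRows, fromCols_mul_fromRows, hBB, transpose_smul, Matrix.smul_mul,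
      Matrix.mul_smul, smul_smul, Real.mul_self_sqrt hs0, hWW, ← diagonal_smul, diagonal_add]
    congr 1
    funext l
    simp [add_assoc]
  have hf0 : ∀ l, 0 < f l ^ 2 := fun l => by have := hf l; positivity
  have hfw0 : ∀ l, 0 < f l ^ 2 + s * w l ^ 2 := fun l =>
    add_pos_of_pos_of_nonneg (hf0 l) (by positivity)
  have hdiag : ∀ i l, diagonal f i l = if l = i then f i else 0 := fun i l => by
    simp [diagonal_apply, eq_comm]
  rw [← Matrix.smul_mul, ← fromRows_mul, ← fromRows_mul]
  obtain ⟨h1, h2, h3⟩ := closed_forms_of_gram hQ he hf0 hy hBB (a := Sum.inl) (b := Sum.inr)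
    Sum.inl_injective (by simp) (fun _ _ => rfl) hdiag
  obtain ⟨h4, h5, h6⟩ := closed_forms_of_gram hQ he hfw0 hy hBB' (a := Sum.inl ∘ Sum.inl)
    (b := Sum.inl ∘ Sum.inr) (Sum.inl_injective.comp Sum.inl_injective) (by simp)
    (fun _ _ => rfl) hdiag
  refine ⟨⟨?_, h2⟩, ?_, ⟨h4, ?_⟩, h6⟩
  · simpa only [div_pow] using h1
  · rw [h3]
    congr 1
    funext i
    rw [sq, mul_div_mul_right _ _ (hf _)]
  · simpa only [add_assoc] using h5

end Debug
end
end

section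
/- Let X ∈ ℝ^{n×p} with XᵀX invertible, X̃ ∈ ℝ^{m×p} arbitrary, η > 0, and T ⊆ [n] with |T| = t. Then λ_min(I_t − X_T(XᵀX + (ηn/m)·X̃ᵀX̃)^{-1}X_Tᵀ) ≥ λ_min(I_t − X_T(XᵀX)^{-1}X_Tᵀ); that is, adding a second data pool never decreases the minimum eigenvalue in the minimum-eigenvalue condition: λ_min(P_{X',TT}^⊥) ≥ λ_min(P_{X,TT}^⊥). -/
open Matrix MeasureTheory ProbabilityTheory
open scoped BigOperators ENNReal

noncomputable section

namespace Debug

/-- The quadratic form of the inverse is antitone in the Loewner order. -/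
theorem dotProduct_inv_add_mulVec_le {ι : Type*} [Fintype ι] [DecidableEq ι]
    {A C : Matrix ι ι ℝ} (hA : A.PosDef) (hC : C.PosSemidef) (w : ι → ℝ) :
    w ⬝ᵥ (A + C)⁻¹ *ᵥ w ≤ w ⬝ᵥ A⁻¹ *ᵥ w := by
  have hx : (A + C) *ᵥ ((A + C)⁻¹ *ᵥ w) = w := by
    rw [mulVec_mulVec, mul_nonsing_inv _ ((isUnit_iff_isUnit_det _).1 (hA.add_posSemidef hC).isUnit),
      one_mulVec]
  have hy : A *ᵥ (A⁻¹ *ᵥ w) = w := by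
    rw [mulVec_mulVec, mul_nonsing_inv _ ((isUnit_iff_isUnit_det _).1 hA.isUnit), one_mulVec]
  generalize (A + C)⁻¹ *ᵥ w = x at *
  generalize A⁻¹ *ᵥ w = y at *
  have hyAx : y ⬝ᵥ A *ᵥ x = x ⬝ᵥ w := by
    have hAt : Aᵀ = A := hA.isHermitian
    rw [← hy, dotProduct_mulVec, ← mulVec_transpose, hAt, dotProduct_comm]
  have hdiff := hA.posSemidef.dotProduct_mulVec_nonneg (y - x)
  have hxC := hC.dotProduct_mulVec_nonneg x
  have hxw : x ⬝ᵥ A *ᵥ x + x ⬝ᵥ C *ᵥ x = x ⬝ᵥ w := by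
    rw [← dotProduct_add, ← add_mulVec, hx]
  simp only [star_trivial, mulVec_sub, sub_dotProduct, dotProduct_sub, hy] at hdiff hxC
  rw [dotProduct_comm w x, dotProduct_comm w y]
  linarith

/-- The quadratic form of a matrix is bounded below on the unit sphere. -/
theorem bddBelow_range_quadForm {ι : Type*} [Fintype ι] (M : Matrix ι ι ℝ) :
    BddBelow (Set.range fun v : {v : ι → ℝ // sqNorm v = 1} => v.1 ⬝ᵥ M.mulVec v.1) := by
  refine ⟨-∑ i, ∑ j, |M i j|, ?_⟩
  rintro _ ⟨⟨v, hv⟩, rfl⟩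
  have hle (i : ι) : |v i| ≤ 1 := by
    rw [← sq_le_one_iff_abs_le_one, ← hv]
    exact Finset.single_le_sum (f := fun i => v i ^ 2) (fun i _ => sq_nonneg _) (Finset.mem_univ i)
  refine neg_le_of_abs_le ?_
  simp only [dotProduct, mulVec, Finset.mul_sum]
  refine (Finset.abs_sum_le_sum_abs _ _).trans (Finset.sum_le_sum fun i _ =>
    (Finset.abs_sum_le_sum_abs _ _).trans (Finset.sum_le_sum fun j _ => ?_))
  rw [abs_mul, abs_mul]
  calc |v i| * (|M i j| * |v j|) ≤ 1 * (|M i j| * 1) := by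
        gcongr
        exacts [hle i, hle j]
    _ = |M i j| := by ring

/-- The minimum Rayleigh quotient is monotone in the quadratic form. -/
theorem minEig_mono {ι : Type*} [Fintype ι] {M N : Matrix ι ι ℝ}
    (h : ∀ v, v ⬝ᵥ M *ᵥ v ≤ v ⬝ᵥ N *ᵥ v) : minEig M ≤ minEig N :=
  ciInf_mono (bddBelow_range_quadForm M) fun v => h v.1

theorem dotProduct_one_sub_mul_mul_transpose_mulVec {ι κ : Type*} [Fintype ι] [Fintype κ]
    [DecidableEq ι] (Y : Matrix ι κ ℝ) (B : Matrix κ κ ℝ) (v : ι → ℝ) :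
    v ⬝ᵥ (1 - Y * B * Yᵀ) *ᵥ v = v ⬝ᵥ v - (Yᵀ *ᵥ v) ⬝ᵥ B *ᵥ (Yᵀ *ᵥ v) := by
  rw [sub_mulVec, one_mulVec, dotProduct_sub, ← mulVec_mulVec, ← mulVec_mulVec,
    dotProduct_mulVec v Y, mulVec_transpose]

/-- adding a second data pool never decreases the minimum eigenvalue
in the minimum-eigenvalue condition (Proposition: comparison of minimum eigenvalue
conditions). -/
theorem statement_9
    (n m p t : ℕ) (hn : 0 < n) (hm : 0 < m)
    (η : ℝ) (hη : 0 < η)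
    (X : Matrix (Fin n) (Fin p) ℝ) (Xt : Matrix (Fin m) (Fin p) ℝ)
    (T : Finset (Fin n)) (hcard : T.card = t)
    (hXX : IsUnit (Xᵀ * X).det) :
    minEig ((1 : Matrix ↥T ↥T ℝ)
        - X.submatrix (fun i : ↥T => i.1) id
          * (Xᵀ * X + ((η * (n : ℝ)) / (m : ℝ)) • (Xtᵀ * Xt))⁻¹
          * (X.submatrix (fun i : ↥T => i.1) id)ᵀ)
      ≥ minEig ((1 : Matrix ↥T ↥T ℝ)
        - X.submatrix (fun i : ↥T => i.1) id * (Xᵀ * X)⁻¹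
          * (X.submatrix (fun i : ↥T => i.1) id)ᵀ) := by
  have hA : (Xᵀ * X).PosDef := by
    have hpsd : (Xᵀ * X).PosSemidef := by
      simpa using posSemidef_conjTranspose_mul_self X
    exact hpsd.posDef_iff_isUnit.2 ((isUnit_iff_isUnit_det _).2 hXX)
  have hC : ((η * (n : ℝ) / (m : ℝ)) • (Xtᵀ * Xt)).PosSemidef :=
    PosSemidef.smul (by simpa using posSemidef_conjTranspose_mul_self Xt) (by positivity)
  refine minEig_mono fun v => ?_
  simp only [dotProduct_one_sub_mul_mul_transpose_mulVec]
  exact sub_le_sub_left (dotProduct_inv_add_mulVec_le hA hC _) _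

end Debug
end
end

section
/- Suppose X_{T^c}ᵀX_{T^c} is invertible. Then the mutual incoherence matrix simplifies as follows: (one pool) P_{X,T^cT}^⊥·(P_{X,TT}^⊥)^{-1} = −X_{T^c}(X_{T^c}ᵀX_{T^c})^{-1}X_Tᵀ; (two pools, for any X̃ ∈ ℝ^{m×p} and η > 0) P_{X',T^cT}^⊥·(P_{X',TT}^⊥)^{-1} = −X_{T^c}(X_{T^c}ᵀX_{T^c} + (ηn/m)·X̃ᵀX̃)^{-1}X_Tᵀ, where the indicated inverses exist. -/
open Matrix MeasureTheory ProbabilityTheory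
open scoped BigOperators ENNReal

noncomputable section

namespace Debug

/-- If `C` and `C + Uᵀ U` are invertible, then multiplying `B (C + Uᵀ U)⁻¹ Uᵀ` by the inverse of
`1 - U (C + Uᵀ U)⁻¹ Uᵀ` gives `B C⁻¹ Uᵀ`. -/
theorem mul_inv_mul_mul_inv_one_sub {ι κ l R : Type*} [Fintype ι] [Fintype κ] [DecidableEq ι]
    [DecidableEq κ] [CommRing R] {C : Matrix κ κ R} {U : Matrix ι κ R} (B : Matrix l κ R)
    (hC : IsUnit C.det) (hG : IsUnit (C + Uᵀ * U).det) :
    B * (C + Uᵀ * U)⁻¹ * Uᵀ * (1 - U * (C + Uᵀ * U)⁻¹ * Uᵀ)⁻¹ = B * C⁻¹ * Uᵀ := by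
  set G := C + Uᵀ * U with hGdef
  have hUU : Uᵀ * U = G - C := by rw [hGdef, add_sub_cancel_left]
  have hcomm : G⁻¹ * (Uᵀ * U) * C⁻¹ = C⁻¹ - G⁻¹ := by
    rw [hUU, Matrix.mul_sub, Matrix.sub_mul, Matrix.nonsing_inv_mul _ hG, Matrix.one_mul,
      Matrix.mul_nonsing_inv_cancel_right _ _ hC]
  have hinv : (1 - U * G⁻¹ * Uᵀ)⁻¹ = 1 + U * C⁻¹ * Uᵀ := by
    apply Matrix.inv_eq_right_inv
    have h : U * G⁻¹ * Uᵀ * (U * C⁻¹ * Uᵀ) = U * C⁻¹ * Uᵀ - U * G⁻¹ * Uᵀ := by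
      rw [← Matrix.sub_mul, ← Matrix.mul_sub, ← hcomm]
      simp only [Matrix.mul_assoc]
    rw [Matrix.sub_mul, Matrix.one_mul, Matrix.mul_add, Matrix.mul_one, h]
    abel
  have h : B * G⁻¹ * Uᵀ * (U * C⁻¹ * Uᵀ) = B * C⁻¹ * Uᵀ - B * G⁻¹ * Uᵀ := by
    rw [← Matrix.sub_mul, ← Matrix.mul_sub, ← hcomm]
    simp only [Matrix.mul_assoc]
  rw [hinv, Matrix.mul_add, Matrix.mul_one, h, add_sub_cancel]

/-- The Gram matrix of `X` is the sum of the Gram matrices of two complementary row blocks. -/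
theorem transpose_mul_self_eq_add_rows {ι κ R : Type*} [Fintype ι] [DecidableEq ι]
    [NonUnitalNonAssocSemiring R] (X : Matrix ι κ R) (T : Finset ι)
    {U : Matrix T κ R} (hU : U = X.submatrix (fun i : T => i.1) id)
    {V : Matrix {i // i ∉ T} κ R} (hV : V = X.submatrix (fun i : {i // i ∉ T} => i.1) id) :
    Xᵀ * X = Vᵀ * V + Uᵀ * U := by
  ext a b
  simp only [hU, hV, Matrix.mul_apply, Matrix.add_apply, Matrix.transpose_apply,
    Matrix.submatrix_apply, id_eq]
  rw [add_comm]
  convert (Fintype.sum_subtype_add_sum_subtype (fun i => i ∈ T) fun i => X i a * X i b).symm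

/-- The simplification with a general positive semidefinite regularizer `S` added to the Gram
matrices. -/
theorem incoherence_add_posSemidef {ι κ : Type*} [Fintype ι] [DecidableEq ι] [Fintype κ]
    [DecidableEq κ] (X : Matrix ι κ ℝ) (T : Finset ι) {S : Matrix κ κ ℝ} (hS : S.PosSemidef)
    {U : Matrix T κ ℝ} (hU : U = X.submatrix (fun i : T => i.1) id)
    {V : Matrix {i // i ∉ T} κ ℝ} (hV : V = X.submatrix (fun i : {i // i ∉ T} => i.1) id)
    (hinv : IsUnit (Vᵀ * V).det) :
    -(V * (Xᵀ * X + S)⁻¹ * Uᵀ) * (1 - U * (Xᵀ * X + S)⁻¹ * Uᵀ)⁻¹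
      = -(V * (Vᵀ * V + S)⁻¹ * Uᵀ) := by
  have hVV : (Vᵀ * V).PosDef := by
    have h : (Vᵀ * V).PosSemidef := by
      simpa using Matrix.posSemidef_conjTranspose_mul_self V
    exact h.posDef_iff_isUnit.2 ((Matrix.isUnit_iff_isUnit_det _).2 hinv)
  have hUU : (Uᵀ * U).PosSemidef := by
    simpa using Matrix.posSemidef_conjTranspose_mul_self U
  have hC : (Vᵀ * V + S).PosDef := hVV.add_posSemidef hS
  have hG : (Vᵀ * V + S + Uᵀ * U).PosDef := hC.add_posSemidef hUU
  have hX : Xᵀ * X + S = Vᵀ * V + S + Uᵀ * U := by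
    rw [transpose_mul_self_eq_add_rows X T hU hV, add_right_comm]
  rw [hX, Matrix.neg_mul, mul_inv_mul_mul_inv_one_sub V
    ((Matrix.isUnit_iff_isUnit_det _).1 hC.isUnit) ((Matrix.isUnit_iff_isUnit_det _).1 hG.isUnit)]

/-- simplification of the mutual incoherence matrices. -/
theorem statement_14
    (n m p t : ℕ) (hn : 0 < n) (hm : 0 < m)
    (η : ℝ) (hη : 0 < η)
    (X : Matrix (Fin n) (Fin p) ℝ) (Xt : Matrix (Fin m) (Fin p) ℝ)
    (T : Finset (Fin n)) (hcard : T.card = t)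
    (XT : Matrix ↥T (Fin p) ℝ) (hXT : XT = X.submatrix (fun i : ↥T => i.1) id)
    (XTc : Matrix {i : Fin n // i ∉ T} (Fin p) ℝ)
    (hXTc : XTc = X.submatrix (fun i : {i : Fin n // i ∉ T} => i.1) id)
    (hinvc : IsUnit (XTcᵀ * XTc).det) :
    -- one pool
    (-(XTc * (Xᵀ * X)⁻¹ * XTᵀ))
        * ((1 : Matrix ↥T ↥T ℝ) - XT * (Xᵀ * X)⁻¹ * XTᵀ)⁻¹
      = -(XTc * (XTcᵀ * XTc)⁻¹ * XTᵀ)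
    -- two pools
    ∧ (-(XTc * (Xᵀ * X + ((η * (n : ℝ)) / (m : ℝ)) • (Xtᵀ * Xt))⁻¹ * XTᵀ))
        * ((1 : Matrix ↥T ↥T ℝ)
            - XT * (Xᵀ * X + ((η * (n : ℝ)) / (m : ℝ)) • (Xtᵀ * Xt))⁻¹ * XTᵀ)⁻¹
      = -(XTc * (XTcᵀ * XTc + ((η * (n : ℝ)) / (m : ℝ)) • (Xtᵀ * Xt))⁻¹ * XTᵀ) := by
  have hXt : (Xtᵀ * Xt).PosSemidef := by
    simpa using Matrix.posSemidef_conjTranspose_mul_self Xt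
  refine ⟨?_, incoherence_add_posSemidef X T (hXt.smul (by positivity)) hXT hXTc hinvc⟩
  simpa only [add_zero] using
    incoherence_add_posSemidef X T Matrix.PosSemidef.zero hXT hXTc hinvc

end Debug
end
end
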